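/- For every real ε > 0, the set of integer-valued polynomials P satisfying |P(n)| ≤ (√(2φ) + ε)·φ^n for every natural number n is infinite. -/

import Mathlib

/-- The golden ratio `(1 + √5)/2`. -/
noncomputable def phi : ℝ := (1 + Real.sqrt 5) / 2

/-- A real polynomial is integer-valued if it sends every integer to an integer. -/
def IsIVP (P : Polynomial ℝ) : Prop := ∀ n : ℤ, ∃ m : ℤ, P.eval (n : ℝ) = (m : ℝ)

open MeasureTheory ProbabilityTheory

theorem pi_gaussianReal_eq_withDensity {ι : Type*} [Fintype ι] :
    Measure.pi (fun _ : ι => gaussianReal 0 1) =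
      (volume : Measure (ι → ℝ)).withDensity
        (fun x => ENNReal.ofReal (∏ i, gaussianPDFReal 0 1 (x i))) := by
  refine Measure.pi_eq fun s hs => ?_
  have hind : ∀ x : ι → ℝ, (Set.univ.pi s).indicator
      (fun x => ENNReal.ofReal (∏ i, gaussianPDFReal 0 1 (x i))) x =
      ENNReal.ofReal (∏ i, (s i).indicator (gaussianPDFReal 0 1) (x i)) := by
    intro x
    by_cases hx : x ∈ Set.univ.pi s
    · rw [Set.indicator_of_mem hx]
      congr 1
      exact Finset.prod_congr rfl fun i _ => (Set.indicator_of_mem (hx i trivial) _).symm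
    · rw [Set.indicator_of_notMem hx]
      obtain ⟨i, hi⟩ : ∃ i, x i ∉ s i := by simpa [Set.mem_pi] using hx
      rw [Finset.prod_eq_zero (Finset.mem_univ i) (Set.indicator_of_notMem hi _)]
      simp
  have h_integrable : ∀ i, Integrable ((s i).indicator (gaussianPDFReal 0 1)) :=
    fun i => (integrable_gaussianPDFReal 0 1).indicator (hs i)
  have hnn : ∀ i x, 0 ≤ (s i).indicator (gaussianPDFReal 0 1) x :=
    fun i x => Set.indicator_nonneg (fun y _ => gaussianPDFReal_nonneg 0 1 y) x
  have hvol : Integrable (fun x : ι → ℝ => ∏ i, (s i).indicator (gaussianPDFReal 0 1) (x i)) :=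
    Integrable.fintype_prod h_integrable
  rw [withDensity_apply _ (MeasurableSet.univ_pi hs),
    ← lintegral_indicator (MeasurableSet.univ_pi hs), lintegral_congr hind,
    ← ofReal_integral_eq_lintegral_ofReal hvol
      (Filter.Eventually.of_forall fun x => Finset.prod_nonneg fun i _ => hnn i _),
    integral_fintype_prod_volume_eq_prod,
    ENNReal.ofReal_prod_of_nonneg fun i _ => integral_nonneg (hnn i)]
  refine Finset.prod_congr rfl fun i _ => ?_
  rw [gaussianReal_apply_eq_integral 0 one_ne_zero, integral_indicator (hs i)]

theorem map_pi_gaussianReal_sum_mul {ι : Type*} [Fintype ι] (v : ι → ℝ) :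
    (Measure.pi (fun _ : ι => gaussianReal 0 1)).map (fun x => ∑ i, v i * x i) =
      gaussianReal 0 (Real.toNNReal (∑ i, v i ^ 2)) := by
  apply Measure.ext_of_charFun
  ext t
  have h := charFun_pi (μ := fun _ : ι => gaussianReal 0 1) (WithLp.toLp 2 fun i => t * v i)
  rw [charFun_apply, integral_map (by fun_prop) (by fun_prop)] at h
  have hmeas : Measurable fun x : ι → ℝ => ∑ i, v i * x i :=
    Continuous.measurable (by fun_prop)
  rw [charFun_apply, integral_map hmeas.aemeasurable (by fun_prop)]
  trans ∏ i, charFun (gaussianReal 0 1) (t * v i)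
  · rw [← h]
    refine integral_congr_ae (Filter.Eventually.of_forall fun x => ?_)
    simp [PiLp.inner_apply, Finset.mul_sum]
    congr 2
    refine Finset.sum_congr rfl fun i _ => by ring
  · simp_rw [charFun_gaussianReal, ← Complex.exp_sum]
    rw [Real.coe_toNNReal _ (Finset.sum_nonneg fun i _ => sq_nonneg _)]
    congr 1
    push_cast
    simp [mul_pow, mul_comm, Finset.mul_sum, Finset.sum_div]

theorem ofReal_exp_integral_le {Ω : Type*} [MeasurableSpace Ω] (μ : Measure Ω)
    [IsProbabilityMeasure μ] {W : Ω → ℝ} (hW : Integrable W μ) :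
    ENNReal.ofReal (Real.exp (∫ x, W x ∂μ)) ≤ ∫⁻ x, ENNReal.ofReal (Real.exp (W x)) ∂μ := by
  by_cases htop : ∫⁻ x, ENNReal.ofReal (Real.exp (W x)) ∂μ = ⊤
  · simp [htop]
  have hexp : Integrable (fun x => Real.exp (W x)) μ := by
    refine (lintegral_ofReal_ne_top_iff_integrable ?_ ?_).1 htop
    · exact Real.continuous_exp.comp_aestronglyMeasurable hW.1
    · exact Filter.Eventually.of_forall fun x => (Real.exp_pos _).le
  rw [← ofReal_integral_eq_lintegral_ofReal hexp
    (Filter.Eventually.of_forall fun x => (Real.exp_pos _).le)]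
  exact ENNReal.ofReal_le_ofReal <| convexOn_exp.map_integral_le
    Real.continuous_exp.continuousOn isClosed_univ (by simp) hW hexp

theorem abs_round_div_le {t : ℝ} (ht : 0 < t) (x : ℝ) :
    |((round (x / (2 * t)) : ℤ) : ℝ)| ≤ ({y | t ≤ |y|} : Set ℝ).indicator (fun y => |y| / t) x := by
  by_cases hx : t ≤ |x|
  · rw [Set.indicator_of_mem (by exact hx)]
    have h := abs_sub_round (x / (2 * t))
    have h1 : |x / (2 * t)| = |x| / t / 2 := by
      rw [abs_div, abs_of_pos (by positivity : 0 < 2 * t)]; field_simp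
    have h2 : 1 ≤ |x| / t := (one_le_div ht).2 hx
    have h3 := abs_sub_abs_le_abs_sub ((round (x / (2 * t)) : ℤ) : ℝ) (x / (2 * t))
    rw [abs_sub_comm] at h3
    linarith
  · rw [Set.indicator_of_notMem (by exact hx)]
    have : round (x / (2 * t)) = 0 := by
      rw [round_eq_zero_iff]
      push Not at hx
      rw [abs_lt] at hx
      constructor
      · rw [le_div_iff₀ (by positivity)]; linarith [hx.1]
      · rw [div_lt_iff₀ (by positivity)]; linarith [hx.2]
    simp [this]

theorem integral_abs_round_gaussianReal_le {p t : ℝ} (hp : 0 < p) (ht : 0 < t) :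
    ∫ x, |((round (x / (2 * t)) : ℤ) : ℝ)| ∂(gaussianReal 0 p.toNNReal) ≤
      2 * √p / (t * √(2 * Real.pi)) * Real.exp (-(t ^ 2) / (2 * p)) := by
  have hpv : p.toNNReal ≠ 0 := by simpa using hp
  have hmeas : MeasurableSet {y : ℝ | t ≤ |y|} := measurableSet_le (by fun_prop) (by fun_prop)
  have h_integrable : Integrable (({y : ℝ | t ≤ |y|}).indicator (fun y => |y| / t))
      (gaussianReal 0 p.toNNReal) :=
    ((((memLp_id_gaussianReal 1).integrable (by simp)).abs).div_const t).indicator hmeas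
  refine (integral_mono_of_nonneg (Filter.Eventually.of_forall fun x => abs_nonneg _) h_integrable
    (Filter.Eventually.of_forall (abs_round_div_le ht))).trans (le_of_eq ?_)
  set C : ℝ := (√(2 * Real.pi * p))⁻¹ with hC
  have hCpos : 0 < C := by positivity
  set g : ℝ → ℝ := (Set.Ici t).indicator
    (fun y => C * Real.exp (-y ^ 2 / (2 * p)) * (y / t)) with hg
  have heq : ∀ x, gaussianPDFReal 0 p.toNNReal x •
      ({y : ℝ | t ≤ |y|}).indicator (fun y => |y| / t) x = g |x| := by
    intro x
    by_cases hx : t ≤ |x|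
    · rw [hg, Set.indicator_of_mem (by exact hx), Set.indicator_of_mem (by exact hx),
        gaussianPDFReal, Real.coe_toNNReal _ hp.le, sub_zero, sq_abs, smul_eq_mul]
    · rw [hg, Set.indicator_of_notMem (by exact hx), Set.indicator_of_notMem (by exact hx),
        smul_zero]
  have hderiv : ∀ y ∈ Set.Ici t, HasDerivAt (fun y => -(C * p / t) * Real.exp (-y ^ 2 / (2 * p)))
      (C * Real.exp (-y ^ 2 / (2 * p)) * (y / t)) y := by
    intro y _
    have h1 : HasDerivAt (fun y : ℝ => -y ^ 2 / (2 * p)) (-(2 * y) / (2 * p)) y := by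
      simpa using ((hasDerivAt_pow 2 y).neg).div_const (2 * p)
    refine (h1.exp.const_mul (-(C * p / t))).congr_deriv ?_
    field_simp
  have hlim : Filter.Tendsto (fun y => -(C * p / t) * Real.exp (-y ^ 2 / (2 * p)))
      Filter.atTop (nhds 0) := by
    rw [← mul_zero (-(C * p / t))]
    refine Filter.Tendsto.const_mul _ (Real.tendsto_exp_atBot.comp ?_)
    refine Filter.Tendsto.atBot_div_const (by positivity) ?_
    exact Filter.tendsto_neg_atTop_atBot.comp (Filter.tendsto_pow_atTop two_ne_zero)
  rw [integral_gaussianReal_eq_integral_smul hpv, integral_congr_ae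
    (Filter.Eventually.of_forall heq), integral_comp_abs, hg,
    setIntegral_indicator measurableSet_Ici,
    Set.inter_eq_right.2 (Set.Ici_subset_Ioi.2 ht), integral_Ici_eq_integral_Ioi,
    integral_Ioi_of_hasDerivAt_of_nonneg' hderiv (fun y hy => ?_) hlim]
  · have h2 : √(2 * Real.pi * p) = √(2 * Real.pi) * √p := Real.sqrt_mul (by positivity) _
    rw [hC, h2]
    nth_rewrite 2 [← Real.mul_self_sqrt hp.le]
    field_simp
    ring
  · have : 0 < y := ht.trans hy
    positivity

theorem measurable_round_real : Measurable (round : ℝ → ℤ) := by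
  simp_rw [funext (round_eq (α := ℝ))]
  exact Int.measurable_floor.comp (measurable_id.add_const _)

theorem measurable_abs_intCast : Measurable fun z : ℤ => |(z : ℝ)| :=
  measurable_of_countable _

theorem hasSum_geometric_natAbs {r : ℝ} (h0 : 0 ≤ r) (h1 : r < 1) :
    HasSum (fun z : ℤ => r ^ z.natAbs) ((1 + r) / (1 - r)) := by
  have hg := hasSum_geometric_of_lt_one h0 h1
  have h := HasSum.of_nat_of_neg_add_one (f := fun z : ℤ => r ^ z.natAbs) (m := (1 - r)⁻¹)
    (m' := r * (1 - r)⁻¹) (by simpa using hg) (by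
      have := hg.mul_left r
      refine this.congr_fun fun n => ?_
      have : (-((n : ℤ) + 1)).natAbs = n + 1 := by omega
      rw [this, pow_succ'])
  have hr : 1 - r ≠ 0 := by linarith
  convert h using 1
  field_simp

theorem log_add_mul_tail_le {p : ℝ} (hp : 0 < p) (hp1 : p ≤ 1) :
    Real.log ((1 + Real.exp (-(1 + 2 / p))) / (1 - Real.exp (-(1 + 2 / p)))) +
      (1 + 2 / p) * (2 * √p / (2 * √(2 * Real.pi)) * Real.exp (-(2 ^ 2) / (2 * p))) ≤
      2 * Real.exp (-2) * p := by
  obtain ⟨v, hv⟩ : ∃ v, v = 1 / p := ⟨_, rfl⟩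
  have hv1 : 1 ≤ v := by rw [hv]; exact (one_le_div hp).2 hp1
  have h2 : 2 / p = 2 * v := by rw [hv]; ring
  have h3 : -(2 ^ 2 : ℝ) / (2 * p) = -(2 * v) := by rw [hv]; field_simp
  have hpv : p * v = 1 := by rw [hv]; field_simp
  have hsp : √p ≤ 1 := Real.sqrt_le_one.2 hp1
  rw [h2, h3]
  set E := Real.exp (-(2 * v)) with hE
  have hEpos : 0 < E := Real.exp_pos _
  have he1 : Real.exp (-1) ≤ 0.368 := by
    rw [Real.exp_neg, inv_le_comm₀ (Real.exp_pos _) (by norm_num)]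
    exact le_trans (by norm_num) Real.exp_one_gt_d9.le
  have hr : Real.exp (-(1 + 2 * v)) = Real.exp (-1) * E := by
    rw [hE, ← Real.exp_add]; congr 1; ring
  have hE2 : E ≤ 0.14 := by
    calc E ≤ Real.exp (-2) := Real.exp_le_exp.2 (by linarith)
      _ = Real.exp (-1) * Real.exp (-1) := by rw [← Real.exp_add]; norm_num
      _ ≤ 0.368 * 0.368 := by gcongr
      _ ≤ 0.14 := by norm_num
  rw [hr]
  set r := Real.exp (-1) * E with hrdef
  have hr0 : 0 < r := by positivity
  have hrE : r ≤ 0.368 * E := by rw [hrdef]; gcongr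
  have hr1 : r ≤ 0.052 := by linarith
  have hlog : Real.log ((1 + r) / (1 - r)) ≤ 0.777 * E := by
    refine (Real.log_le_sub_one_of_pos (div_pos (by linarith) (by linarith))).trans ?_
    rw [sub_le_iff_le_add, div_le_iff₀ (by linarith)]
    nlinarith
  have hpi : 2.5 ≤ √(2 * Real.pi) := by
    apply Real.le_sqrt_of_sq_le
    nlinarith [Real.pi_gt_d2]
  have htail : 2 * √p / (2 * √(2 * Real.pi)) * E ≤ 0.4 * E := by
    gcongr
    rw [div_le_iff₀ (by positivity)]
    linarith
  have hsq : v ^ 2 * E ≤ Real.exp (-2) := by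
    have h := Real.add_one_le_exp (v - 1)
    have : v ^ 2 ≤ Real.exp (v - 1) ^ 2 := by gcongr; linarith
    calc v ^ 2 * E ≤ Real.exp (v - 1) ^ 2 * E := by gcongr
      _ = Real.exp (-2) := by rw [hE, ← Real.exp_nat_mul, ← Real.exp_add]; congr 1; push_cast; ring
  calc _ ≤ 0.777 * E + (1 + 2 * v) * (0.4 * E) := by gcongr
    _ ≤ 2 * v * E := by nlinarith
    _ = 2 * (v ^ 2 * E) * p := by linear_combination (-2 * v * E) * hpv
    _ ≤ _ := by gcongr

theorem integral_cell_cost_le {ι : Type*} [Fintype ι] (v : ι → ℝ)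
    (h0 : 0 < ∑ i, v i ^ 2) :
    Integrable (fun x : ι → ℝ => |((round ((∑ i, v i * x i) / 4) : ℤ) : ℝ)|)
        (Measure.pi fun _ : ι => gaussianReal 0 1) ∧
      ∫ x, |((round ((∑ i, v i * x i) / 4) : ℤ) : ℝ)| ∂(Measure.pi fun _ : ι => gaussianReal 0 1)
        ≤ 2 * √(∑ i, v i ^ 2) / (2 * √(2 * Real.pi)) *
          Real.exp (-(2 ^ 2) / (2 * ∑ i, v i ^ 2)) := by
  have hmeas : Measurable fun x : ι → ℝ => ∑ i, v i * x i :=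
    Continuous.measurable (by fun_prop)
  have hm : Measurable fun y : ℝ => |((round (y / 4) : ℤ) : ℝ)| :=
    measurable_abs_intCast.comp (measurable_round_real.comp (measurable_id.div_const 4))
  have hmap := map_pi_gaussianReal_sum_mul v
  have h4 : (4 : ℝ) = 2 * 2 := by norm_num
  constructor
  · change Integrable ((fun y : ℝ => |((round (y / 4) : ℤ) : ℝ)|) ∘ _) _
    rw [← integrable_map_measure hm.aestronglyMeasurable hmeas.aemeasurable, hmap]
    refine Integrable.mono' (((memLp_id_gaussianReal 1).integrable (by simp)).abs.div_const 2)
      hm.aestronglyMeasurable (Filter.Eventually.of_forall fun y => ?_)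
    rw [Real.norm_eq_abs, abs_abs, h4]
    refine (abs_round_div_le two_pos y).trans ?_
    exact Set.indicator_le_self' (fun _ _ => by positivity) y
  · have := integral_abs_round_gaussianReal_le h0 two_pos
    rw [← hmap, integral_map hmeas.aemeasurable (h4 ▸ hm.aestronglyMeasurable)] at this
    rwa [h4]

theorem integral_sum_sq_pi_gaussianReal {ι : Type*} [Fintype ι] :
    Integrable (fun x : ι → ℝ => ∑ i, x i ^ 2) (Measure.pi fun _ : ι => gaussianReal 0 1) ∧
      ∫ x, ∑ i, x i ^ 2 ∂(Measure.pi fun _ : ι => gaussianReal 0 1) = Fintype.card ι := by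
  have hi : Integrable (fun y : ℝ => y ^ 2) (gaussianReal 0 1) :=
    (memLp_id_gaussianReal 2).integrable_sq
  have h1 : ∀ i : ι, Integrable (fun x : ι → ℝ => x i ^ 2)
      (Measure.pi fun _ : ι => gaussianReal 0 1) := fun i =>
    integrable_comp_eval (μ := fun _ : ι => gaussianReal 0 1) (f := fun y : ℝ => y ^ 2) hi
  have hv : ∫ y : ℝ, y ^ 2 ∂(gaussianReal 0 1) = 1 := by
    have := variance_id_gaussianReal (μ := 0) (v := 1)
    rw [variance_of_integral_eq_zero aemeasurable_id (by simp)] at this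
    simpa using this
  refine ⟨integrable_finsetSum _ fun i _ => h1 i, ?_⟩
  rw [integral_finsetSum _ fun i _ => h1 i]
  have : ∀ i : ι, ∫ x : ι → ℝ, x i ^ 2 ∂(Measure.pi fun _ : ι => gaussianReal 0 1) = 1 := by
    intro i
    rw [integral_comp_eval (μ := fun _ : ι => gaussianReal 0 1) (f := fun y : ℝ => y ^ 2) (i := i)
      (by fun_prop), hv]
  simp [this]

theorem lintegral_prod_weight_le {α κ : Type*} [MeasurableSpace α] [Fintype κ]
    (μ : Measure α) {Z : α → κ → ℤ} (hZ : Measurable Z) {m : ENNReal}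
    (hm : ∀ z, μ (Z ⁻¹' {z}) ≤ m) {w : κ → ℤ → ENNReal} (hw : ∀ n, ∑' z, w n z = 1) :
    ∫⁻ x, ∏ n, w n (Z x n) ∂μ ≤ m := by
  let ν : κ → Measure ℤ := fun n => Measure.count.withDensity (w n)
  have hν : ∀ n z, ν n {z} = w n z := fun n z => by
    simp [ν, withDensity_apply]
  have hprob : ∀ n, IsProbabilityMeasure (ν n) := fun n => ⟨by
    simp [ν, withDensity_apply, lintegral_count, hw]⟩
  have hpi : ∀ z : κ → ℤ, ∏ n, w n (z n) = Measure.pi ν {z} := fun z => by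
    simp_rw [Measure.pi_singleton, hν]
  have hcount : Countable (κ → ℤ) := inferInstance
  calc ∫⁻ x, ∏ n, w n (Z x n) ∂μ = ∫⁻ z, ∏ n, w n (z n) ∂(μ.map Z) :=
        (lintegral_map (f := fun z : κ → ℤ => ∏ n, w n (z n)) (measurable_of_countable _) hZ).symm
    _ = ∑' z, (∏ n, w n (z n)) * μ.map Z {z} := lintegral_countable' _
    _ ≤ ∑' z, Measure.pi ν {z} * m := by
        refine ENNReal.tsum_le_tsum fun z => ?_
        rw [hpi, Measure.map_apply hZ (measurableSet_singleton z)]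
        gcongr
        exact hm z
    _ = m := by
        have h1 : ∑' z, Measure.pi ν {z} = 1 := by
          have := lintegral_countable' (μ := Measure.pi ν) (fun _ => 1)
          simpa using this.symm
        rw [ENNReal.tsum_mul_right, h1, one_mul]

/-- If the forms `v n` have norm at most `1` and total squared norm at most the dimension, then some
cell of points on which all the forms round in the same way has large volume: the Gaussian entropy
exceeds the total entropy of the rounded forms. -/
theorem ofReal_exp_le_of_volume_cell_le {ι κ : Type*} [Fintype ι] [Fintype κ] (v : κ → ι → ℝ)
    (h0 : ∀ n, 0 < ∑ i, v n i ^ 2) (h1 : ∀ n, ∑ i, v n i ^ 2 ≤ 1)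
    (htr : ∑ n, ∑ i, v n i ^ 2 ≤ Fintype.card ι) {m : ENNReal}
    (hm : ∀ z : κ → ℤ,
      volume {x : ι → ℝ | ∀ n, round ((∑ i, v n i * x i) / 4) = z n} ≤ m) :
    ENNReal.ofReal (Real.exp (Fintype.card ι *
      ((1 + Real.log (2 * Real.pi)) / 2 - 2 * Real.exp (-2)))) ≤ m := by
  set γ : Measure (ι → ℝ) := Measure.pi fun _ : ι => gaussianReal 0 1 with hγ
  set p : κ → ℝ := fun n => ∑ i, v n i ^ 2 with hp
  set Z : (ι → ℝ) → κ → ℤ := fun x n => round ((∑ i, v n i * x i) / 4) with hZdef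
  have hlin : ∀ n, Measurable fun x : ι → ℝ => ∑ i, v n i * x i := fun n =>
    Continuous.measurable (by fun_prop)
  have hZ : Measurable Z := measurable_pi_lambda _ fun n =>
    measurable_round_real.comp ((hlin n).div_const 4)
  set r : κ → ℝ := fun n => Real.exp (-(1 + 2 / p n)) with hr
  have hr0 : ∀ n, 0 < r n := fun n => Real.exp_pos _
  have hr1 : ∀ n, r n < 1 := fun n => by
    have : 0 < 2 / p n := div_pos two_pos (h0 n)
    exact (Real.exp_lt_exp.2 (by linarith)).trans_eq Real.exp_zero
  set b : κ → ℝ := fun n => Real.log ((1 + r n) / (1 - r n)) with hb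
  have hq : ∀ n, 0 < (1 + r n) / (1 - r n) := fun n =>
    div_pos (by linarith [hr0 n]) (by linarith [hr1 n])
  set w : κ → ℤ → ℝ := fun n z => Real.exp (-(b n + (1 + 2 / p n) * |(z : ℝ)|)) with hw
  have hwsum : ∀ n, HasSum (w n) 1 := fun n => by
    have := (hasSum_geometric_natAbs (hr0 n).le (hr1 n)).mul_left ((1 + r n) / (1 - r n))⁻¹
    rw [inv_mul_cancel₀ (hq n).ne'] at this
    refine this.congr_fun fun z => ?_
    rw [hw, hr]
    simp only
    rw [neg_add, Real.exp_add, Real.exp_neg, hb]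
    simp only
    rw [Real.exp_log (hq n), ← Real.exp_nat_mul, Nat.cast_natAbs, Int.cast_abs]
    congr 2
    ring
  have hle := lintegral_prod_weight_le volume hZ (m := m) (fun z => by
      refine le_trans (le_of_eq ?_) (hm z)
      congr 1
      ext x
      simp [hZdef, funext_iff]) (w := fun n z => ENNReal.ofReal (w n z)) (fun n => by
      rw [← ENNReal.ofReal_tsum_of_nonneg (fun z => (Real.exp_pos _).le) (hwsum n).summable,
        (hwsum n).tsum_eq, ENNReal.ofReal_one])
  set W : (ι → ℝ) → ℝ := fun x => (∑ n, -(b n + (1 + 2 / p n) * |(Z x n : ℝ)|)) +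
    (∑ i, x i ^ 2) / 2 + Fintype.card ι * (Real.log (2 * Real.pi) / 2) with hW
  have hWρ : ∀ x, ENNReal.ofReal (∏ i, gaussianPDFReal 0 1 (x i)) * ENNReal.ofReal (Real.exp (W x))
      = ∏ n, ENNReal.ofReal (w n (Z x n)) := by
    intro x
    rw [← ENNReal.ofReal_mul (Finset.prod_nonneg fun i _ => gaussianPDFReal_nonneg 0 1 _),
      ← ENNReal.ofReal_prod_of_nonneg fun n _ => (Real.exp_pos _).le]
    congr 1
    have hpdf : ∀ y, gaussianPDFReal 0 1 y =
        Real.exp (-(y ^ 2 / 2 + Real.log (2 * Real.pi) / 2)) := by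
      intro y
      rw [gaussianPDFReal, neg_add, Real.exp_add, Real.exp_neg (Real.log _ / 2), ← Real.log_sqrt
        (by positivity), Real.exp_log (by positivity)]
      simp [mul_comm, neg_div]
    change _ = ∏ n, Real.exp (-(b n + (1 + 2 / p n) * |(Z x n : ℝ)|))
    simp_rw [hpdf, ← Real.exp_sum]
    rw [← Real.exp_add, hW]
    congr 1
    simp only [Finset.sum_neg_distrib, Finset.sum_add_distrib, Finset.sum_div, Finset.sum_const,
      Finset.card_univ, nsmul_eq_mul]
    ring
  have hcost : ∀ n, Integrable (fun x => |(Z x n : ℝ)|) γ ∧ ∫ x, |(Z x n : ℝ)| ∂γ ≤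
      2 * √(p n) / (2 * √(2 * Real.pi)) * Real.exp (-(2 ^ 2) / (2 * p n)) := fun n =>
    integral_cell_cost_le (v n) (h0 n)
  have hsq := integral_sum_sq_pi_gaussianReal (ι := ι)
  have hterm : ∀ n, Integrable (fun x => -(b n + (1 + 2 / p n) * |(Z x n : ℝ)|)) γ := fun n =>
    ((integrable_const _).add ((hcost n).1.const_mul _)).neg
  have hsum : Integrable (fun x => ∑ n, -(b n + (1 + 2 / p n) * |(Z x n : ℝ)|)) γ :=
    integrable_finsetSum _ fun n _ => hterm n
  have hWint : Integrable W γ := (hsum.add (hsq.1.div_const 2)).add (integrable_const _)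
  have hWge : Fintype.card ι * ((1 + Real.log (2 * Real.pi)) / 2 - 2 * Real.exp (-2)) ≤
      ∫ x, W x ∂γ := by
    have hI : ∫ x, W x ∂γ = (∑ n, -(b n + (1 + 2 / p n) * ∫ x, |(Z x n : ℝ)| ∂γ)) +
        Fintype.card ι / 2 + Fintype.card ι * (Real.log (2 * Real.pi) / 2) := by
      refine (integral_add (hsum.add (hsq.1.div_const 2)) (integrable_const _)).trans ?_
      rw [integral_add' hsum (hsq.1.div_const 2), integral_div, hsq.2,
        integral_finsetSum _ fun n _ => hterm n]
      congr 2
      · refine Finset.sum_congr rfl fun n _ => ?_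
        rw [integral_neg, integral_add (integrable_const _) ((hcost n).1.const_mul _),
          integral_const_mul]
        simp
      · simp
    have hS : ∑ n, -(2 * Real.exp (-2) * p n) ≤
        ∑ n, -(b n + (1 + 2 / p n) * ∫ x, |(Z x n : ℝ)| ∂γ) := by
      refine Finset.sum_le_sum fun n _ => neg_le_neg ?_
      refine le_trans ?_ (log_add_mul_tail_le (h0 n) (h1 n))
      have := div_pos two_pos (h0 n)
      gcongr
      exact (hcost n).2
    rw [Finset.sum_neg_distrib, ← Finset.mul_sum] at hS
    have := mul_le_mul_of_nonneg_left htr (by positivity : 0 ≤ 2 * Real.exp (-2))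
    rw [hI]
    linarith
  calc _ ≤ ENNReal.ofReal (Real.exp (∫ x, W x ∂γ)) := by gcongr
    _ ≤ ∫⁻ x, ENNReal.ofReal (Real.exp (W x)) ∂γ := ofReal_exp_integral_le γ hWint
    _ = ∫⁻ x, ENNReal.ofReal (∏ i, gaussianPDFReal 0 1 (x i)) *
          ENNReal.ofReal (Real.exp (W x)) := by
        have hWm : Measurable W := by
          have hZn : ∀ n, Measurable fun x => |(Z x n : ℝ)| := fun n =>
            measurable_abs_intCast.comp ((measurable_pi_apply n).comp hZ)
          refine ((Finset.measurable_sum _ fun n _ => ?_).add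
            (Continuous.measurable (by fun_prop))).add_const _
          exact (((hZn n).const_mul _).const_add _).neg
        rw [hγ, pi_gaussianReal_eq_withDensity, lintegral_withDensity_eq_lintegral_mul _ ?_
          hWm.exp.ennreal_ofReal]
        · rfl
        · exact (Finset.measurable_prod _ fun i _ => (measurable_gaussianPDFReal 0 1).comp
            (measurable_pi_apply i)).ennreal_ofReal
    _ = ∫⁻ x, ∏ n, ENNReal.ofReal (w n (Z x n)) := by simp_rw [hWρ]
    _ ≤ m := hle

/-- Blichfeldt's principle for the integer lattice. -/
theorem volume_le_of_encard_lattice_le {ι : Type*} [Fintype ι] {A : Set (ι → ℝ)}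
    (hA : MeasurableSet A) {m : ℕ}
    (hm : ∀ x : ι → ℝ, {c : ι → ℤ | (fun i => (c i : ℝ) + x i) ∈ A}.encard ≤ m) :
    volume A ≤ m := by
  classical
  set b := Pi.basisFun ℝ ι
  set Λ := Submodule.span ℤ (Set.range b)
  have hfund := ZSpan.isAddFundamentalDomain b (volume : Measure (ι → ℝ))
  have hvol : volume (ZSpan.fundamentalDomain b) = 1 := by
    rw [ZSpan.volume_fundamentalDomain]
    have : Matrix.of b = 1 := by
      ext i j
      simp [b, Matrix.one_apply, Pi.single_apply, eq_comm]
    simp [this]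
  have hinv : VAddInvariantMeasure Λ (ι → ℝ) volume :=
    ⟨fun g s _ => measure_preimage_add volume (g : ι → ℝ) s⟩
  have hpt : ∀ x, ∑' g : Λ, A.indicator (1 : (ι → ℝ) → ENNReal) (g +ᵥ x) ≤ m := by
    intro x
    have hinj : Set.InjOn (fun (g : Λ) (i : ι) => ⌊(g : ι → ℝ) i⌋) {g : Λ | g +ᵥ x ∈ A} := by
      intro g _ g' _ h
      ext i
      have hi : ∀ g : Λ, ((⌊(g : ι → ℝ) i⌋ : ℤ) : ℝ) = (g : ι → ℝ) i := by
        intro g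
        obtain ⟨k, hk⟩ := (b.mem_span_iff_repr_mem ℤ (g : ι → ℝ)).1 g.2 i
        have hk' : (k : ℝ) = (g : ι → ℝ) i := by simpa [b] using hk
        rw [← hk', Int.floor_intCast]
      rw [← hi g, ← hi g']
      exact congrArg _ (congrFun h i)
    have hsub : (fun (g : Λ) (i : ι) => ⌊(g : ι → ℝ) i⌋) '' {g : Λ | g +ᵥ x ∈ A} ⊆
        {c : ι → ℤ | (fun i => (c i : ℝ) + x i) ∈ A} := by
      rintro _ ⟨g, hg, rfl⟩
      have : (fun i => ((⌊(g : ι → ℝ) i⌋ : ℤ) : ℝ) + x i) = g +ᵥ x := by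
        ext i
        obtain ⟨k, hk⟩ := (b.mem_span_iff_repr_mem ℤ (g : ι → ℝ)).1 g.2 i
        have hk' : (k : ℝ) = (g : ι → ℝ) i := by simpa [b] using hk
        rw [← hk', Int.floor_intCast, hk']
        rfl
      simpa [this] using hg
    calc ∑' g : Λ, A.indicator (1 : (ι → ℝ) → ENNReal) (g +ᵥ x)
        = ∑' g : Λ, ({g : Λ | g +ᵥ x ∈ A}).indicator (fun _ => (1 : ENNReal)) g := rfl
      _ = ({g : Λ | g +ᵥ x ∈ A}.encard : ENNReal) := by
          rw [← tsum_subtype, ENNReal.tsum_set_one]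
      _ ≤ ((m : ℕ∞) : ENNReal) := by
          rw [← hinj.encard_image]
          exact_mod_cast (Set.encard_le_encard hsub).trans (hm x)
      _ = m := by simp
  calc volume A = ∫⁻ x, A.indicator 1 x := (lintegral_indicator_one hA).symm
    _ = ∑' g : Λ, ∫⁻ x in ZSpan.fundamentalDomain b, A.indicator 1 (g +ᵥ x) :=
        hfund.lintegral_eq_tsum'' _
    _ = ∫⁻ x in ZSpan.fundamentalDomain b, ∑' g : Λ, A.indicator 1 (g +ᵥ x) := by
        refine (lintegral_tsum fun g => ?_).symm
        exact ((measurable_one.indicator hA).comp (measurable_const_vadd g)).aemeasurable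
    _ ≤ ∫⁻ x in ZSpan.fundamentalDomain b, m := lintegral_mono hpt
    _ = m := by simp [hvol]

theorem phi_sq : phi ^ 2 = phi + 1 := Real.goldenRatio_sq

theorem one_lt_phi : 1 < phi := Real.one_lt_goldenRatio

theorem phi_pos : 0 < phi := one_pos.trans one_lt_phi

theorem phi_inv : phi⁻¹ = phi - 1 := by
  rw [inv_eq_iff_eq_inv, eq_comm, inv_eq_iff_eq_inv, eq_comm]
  have := phi_sq
  field_simp [phi_pos.ne']
  linarith

/-- The Meixner functions attached to the weight `φ⁻²ⁿ`, up to sign. -/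
noncomputable def meixner : ℕ → ℕ → ℝ
  | 0, n => phi⁻¹ ^ n
  | k + 1, 0 => phi⁻¹ ^ (k + 1)
  | k + 1, n + 1 => phi⁻¹ * meixner (k + 1) n - meixner k n + phi⁻¹ * meixner k (n + 1)

theorem meixner_zero_right (k : ℕ) : meixner k 0 = phi⁻¹ ^ k := by
  cases k <;> simp [meixner]

theorem meixner_comm (k n : ℕ) : meixner k n = meixner n k := by
  induction k generalizing n with
  | zero => rw [meixner_zero_right, meixner]
  | succ k ihk =>
    induction n with
    | zero => rw [meixner_zero_right, meixner]
    | succ n ihn =>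
      rw [meixner, meixner, ihn, ihk n, ihk (n + 1)]
      ring

theorem sum_meixner_succ_sq_le (k N : ℕ) :
    ∑ n ∈ Finset.range N, meixner (k + 1) n ^ 2 ≤ ∑ n ∈ Finset.range N, meixner k n ^ 2 := by
  let f : ℕ → ℝ := fun n => Nat.rec (meixner k 0) (fun n y => meixner k (n + 1) + phi⁻¹ * y) n
  have hf : ∀ n, meixner k (n + 1) = f (n + 1) - phi⁻¹ * f n := fun n => by simp [f]
  have hf0 : meixner k 0 = f 0 := rfl
  have hg : ∀ n, meixner (k + 1) (n + 1) = phi⁻¹ * f (n + 1) - f n := by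
    intro n
    induction n with
    | zero =>
      rw [meixner, hf, hf0, meixner_zero_right, pow_succ, ← meixner_zero_right, hf0]
      ring
    | succ n ih =>
      rw [meixner, ih, hf, hf]
      ring
  have hc : phi⁻¹ ^ 2 ≤ 1 := pow_le_one₀ (by have := phi_pos; positivity)
    (inv_le_one_of_one_le₀ one_lt_phi.le)
  have key : ∀ N, ∑ n ∈ Finset.range (N + 1), meixner (k + 1) n ^ 2 + (1 - phi⁻¹ ^ 2) * f N ^ 2 =
      ∑ n ∈ Finset.range (N + 1), meixner k n ^ 2 := by
    intro N
    induction N with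
    | zero =>
      simp only [zero_add, Finset.sum_range_one]
      have h0 : meixner (k + 1) 0 = phi⁻¹ * f 0 := by
        rw [meixner_zero_right, pow_succ', ← meixner_zero_right, hf0]
      rw [h0, hf0]
      ring
    | succ N ih =>
      rw [Finset.sum_range_succ, Finset.sum_range_succ (n := N + 1), ← ih, hf, hg]
      ring
  cases N with
  | zero => simp
  | succ N =>
    rw [← key N]
    nlinarith [mul_nonneg (sub_nonneg.2 hc) (sq_nonneg (f N))]

theorem sum_meixner_sq_le (k N : ℕ) : ∑ n ∈ Finset.range N, meixner k n ^ 2 ≤ phi := by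
  induction k with
  | zero =>
    have h0 := phi_pos
    have hlt : phi⁻¹ ^ 2 < 1 := pow_lt_one₀ (by positivity)
      (inv_lt_one_of_one_lt₀ one_lt_phi) two_ne_zero
    calc ∑ n ∈ Finset.range N, meixner 0 n ^ 2 = ∑ n ∈ Finset.range N, (phi⁻¹ ^ 2) ^ n :=
          Finset.sum_congr rfl fun n _ => by rw [meixner, ← pow_mul, ← pow_mul, mul_comm]
      _ ≤ ∑' n, (phi⁻¹ ^ 2) ^ n :=
          (summable_geometric_of_lt_one (by positivity) hlt).sum_le_tsum _
            (fun n _ => by positivity)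
      _ = (1 - phi⁻¹ ^ 2)⁻¹ := tsum_geometric_of_lt_one (by positivity) hlt
      _ = phi := by
          have : 1 - phi⁻¹ ^ 2 = phi⁻¹ := by
            rw [phi_inv]; nlinarith [phi_sq]
          rw [this, inv_inv]
  | succ k ih => exact (sum_meixner_succ_sq_le k N).trans ih

open Polynomial in
theorem natDegree_C_sub_X_le (a : ℝ) : (C a - X : ℝ[X]).natDegree ≤ 1 :=
  natDegree_sub_le_of_le ((natDegree_C a).trans_le zero_le_one) natDegree_X_le

open Polynomial in
theorem coeff_C_sub_X_pow_of_lt (a : ℝ) {k j : ℕ} (h : k < j) :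
    ((C a - X) ^ k : ℝ[X]).coeff j = 0 :=
  coeff_eq_zero_of_natDegree_lt <| (natDegree_pow_le.trans
    (Nat.mul_le_mul_left k (natDegree_C_sub_X_le a))).trans_lt (by simpa using h)

open Polynomial in
theorem coeff_C_sub_X_pow_self (a : ℝ) (k : ℕ) : ((C a - X) ^ k : ℝ[X]).coeff k = (-1) ^ k := by
  simpa using coeff_pow_of_natDegree_le (m := k) (natDegree_C_sub_X_le a)

open Polynomial in
theorem phi_pow_mul_meixner (k n : ℕ) : phi ^ n * meixner k n =
    ∑ j ∈ Finset.range (k + 1), ((C phi⁻¹ - X) ^ k : ℝ[X]).coeff j * (n.choose j : ℝ) := by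
  have hφ := phi_pos.ne'
  induction k generalizing n with
  | zero =>
    simp [meixner, hφ]
  | succ k ihk =>
    induction n with
    | zero =>
      rw [Finset.sum_eq_single 0 (fun j _ hj => by simp [Nat.choose_eq_zero_of_lt
        (Nat.pos_of_ne_zero hj)]) (by simp)]
      simp [meixner_zero_right, coeff_zero_eq_eval_zero]
    | succ n ihn =>
      have h1 : phi ^ (n + 1) * meixner (k + 1) (n + 1) = phi ^ n * meixner (k + 1) n -
          (phi⁻¹ + 1) * (phi ^ n * meixner k n) + phi⁻¹ * (phi ^ (n + 1) * meixner k (n + 1)) := by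
        rw [meixner, phi_inv]
        have := phi_sq
        linear_combination (phi ^ n * meixner (k + 1) n) * this
      rw [h1, ihn, ihk, ihk, Finset.sum_range_succ' _ (k + 1), Finset.sum_range_succ' _ (k + 1)]
      have hext : ∀ n : ℕ, ∑ j ∈ Finset.range (k + 1),
          ((C phi⁻¹ - X) ^ k : ℝ[X]).coeff j * (n.choose j : ℝ) = ∑ j ∈ Finset.range (k + 1),
          ((C phi⁻¹ - X) ^ k : ℝ[X]).coeff (j + 1) * (n.choose (j + 1) : ℝ) +
            ((C phi⁻¹ - X) ^ k : ℝ[X]).coeff 0 := by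
        intro n
        rw [Finset.sum_range_succ', Finset.sum_range_succ, coeff_C_sub_X_pow_of_lt _ k.lt_succ_self]
        simp
      have hco : ∀ j, ((C phi⁻¹ - X) ^ (k + 1) : ℝ[X]).coeff (j + 1) =
          phi⁻¹ * ((C phi⁻¹ - X) ^ k : ℝ[X]).coeff (j + 1) - ((C phi⁻¹ - X) ^ k : ℝ[X]).coeff j := by
        intro j
        rw [pow_succ', sub_mul, coeff_sub, coeff_C_mul, coeff_X_mul]
      have hch : ∀ j, (((n + 1).choose (j + 1) : ℕ) : ℝ) = n.choose j + n.choose (j + 1) := by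
        intro j; rw [Nat.choose_succ_succ]; push_cast; ring
      simp only [hco]
      rw [add_mul, one_mul, hext (n + 1), sub_add_eq_sub_sub]
      nth_rewrite 1 [hext n]
      simp only [hch, Nat.choose_zero_right]
      rw [← sub_eq_zero]
      simp only [mul_add, Finset.mul_sum, sub_mul, Finset.sum_add_distrib, Finset.sum_sub_distrib]
      simp only [← mul_assoc]
      ring

theorem abs_sub_le_one_of_round_eq {a b : ℝ} (h : round a = round b) : |a - b| ≤ 1 := by
  have ha := abs_le.1 (abs_sub_round a)
  have hb := abs_le.1 (abs_sub_round b)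
  rw [h] at ha
  rw [abs_le]
  constructor <;> linarith [ha.1, ha.2, hb.1, hb.2]

/-- The integer-valued polynomial with prescribed coefficients in the binomial basis. -/
noncomputable def chooseSum {D : ℕ} (c : Fin D → ℤ) : Polynomial ℝ :=
  ∑ j, Polynomial.C ((c j : ℝ) / ((j : ℕ).factorial : ℝ)) * descPochhammer ℝ j

theorem isIVP_chooseSum {D : ℕ} (c : Fin D → ℤ) : IsIVP (chooseSum c) := by
  intro n
  refine ⟨∑ j, c j * Ring.choose n j, ?_⟩
  simp only [chooseSum, Polynomial.eval_finsetSum, Polynomial.eval_mul, Polynomial.eval_C]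
  push_cast
  refine Finset.sum_congr rfl fun j _ => ?_
  have h := Ring.descPochhammer_eq_factorial_smul_choose n (j : ℕ)
  rw [← Polynomial.eval_eq_smeval, nsmul_eq_mul] at h
  have h' : (descPochhammer ℝ j).eval (n : ℝ) = ((j : ℕ).factorial : ℝ) * Ring.choose n j := by
    rw [← descPochhammer_map (Int.castRingHom ℝ), Polynomial.eval_intCast_map, Int.cast_id, h]
    simp
  rw [h']
  have := Nat.factorial_pos (j : ℕ)
  field_simp

theorem eval_chooseSum {D : ℕ} (c : Fin D → ℤ) (n : ℕ) :
    (chooseSum c).eval (n : ℝ) = ∑ j, (c j : ℝ) * (n.choose j : ℝ) := by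
  simp only [chooseSum, Polynomial.eval_finsetSum, Polynomial.eval_mul, Polynomial.eval_C,
    descPochhammer_eval_eq_descFactorial, Nat.descFactorial_eq_factorial_mul_choose]
  refine Finset.sum_congr rfl fun j _ => ?_
  have := Nat.factorial_pos (j : ℕ)
  push_cast
  field_simp

theorem chooseTransform_injective (D : ℕ) :
    Function.Injective fun (c : Fin D → ℤ) (n : Fin D) => ∑ j, c j * ((n : ℕ).choose j : ℤ) := by
  let B : Matrix (Fin D) (Fin D) ℤ := Matrix.of fun n j => ((n : ℕ).choose j : ℤ)
  have hB : B.det = 1 := by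
    rw [Matrix.det_of_isLowerTriangular _ fun i j hij => ?_]
    · simp [B]
    · exact Int.natCast_eq_zero.2 (Nat.choose_eq_zero_of_lt (OrderDual.toDual_lt_toDual.1 hij))
  have := Matrix.mulVec_injective_of_isUnit
    ((Matrix.isUnit_iff_isUnit_det B).2 (by simp [hB]))
  intro c c' h
  refine this ?_
  ext n
  simpa [Matrix.mulVec, dotProduct, B, mul_comm] using congrFun h n

theorem chooseSum_injective (D : ℕ) : Function.Injective (chooseSum : (Fin D → ℤ) → _) := by
  intro c c' h
  refine chooseTransform_injective D (funext fun n => ?_)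
  have := congrArg (Polynomial.eval ((n : ℕ) : ℝ)) h
  rw [eval_chooseSum, eval_chooseSum] at this
  exact_mod_cast this

theorem finite_forall_abs_chooseSum_le (D : ℕ) (B : ℕ → ℝ) :
    {c : Fin D → ℤ | ∀ n < D, |(chooseSum c).eval (n : ℝ)| ≤ B n}.Finite := by
  refine ((Set.finite_Icc (fun n : Fin D => -⌊B n⌋) fun n : Fin D => ⌊B n⌋).preimage
    (chooseTransform_injective D).injOn).subset fun c hc => ?_
  have h : ∀ n : Fin D, |∑ j, c j * ((n : ℕ).choose j : ℤ)| ≤ ⌊B n⌋ := by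
    intro n
    have := hc n n.2
    rw [eval_chooseSum] at this
    rw [Int.le_floor]
    exact_mod_cast this
  exact ⟨fun n => (abs_le.1 (h n)).1, fun n => (abs_le.1 (h n)).2⟩

theorem eventually_abs_eval_le (P : Polynomial ℝ) {K r : ℝ} (hK : 0 < K) (hr : 1 < r) :
    ∀ᶠ n : ℕ in Filter.atTop, |P.eval (n : ℝ)| ≤ K * r ^ n := by
  have h : (fun n : ℕ => P.eval (n : ℝ)) =o[Filter.atTop] fun n : ℕ => r ^ n := by
    simp only [Polynomial.eval_eq_sum_range]
    exact Asymptotics.IsLittleO.fun_sum fun i _ =>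
      (isLittleO_pow_const_const_pow_of_one_lt (R := ℝ) i hr).const_mul_left (P.coeff i)
  filter_upwards [h.def hK] with n hn
  rwa [Real.norm_eq_abs, Real.norm_of_nonneg (by positivity)] at hn

theorem exists_forall_lt_imp_forall (D : ℕ) {K r : ℝ} (hK : 0 < K) (hr : 1 < r) :
    ∃ N : ℕ, ∀ c : Fin D → ℤ, (∀ n < N, |(chooseSum c).eval (n : ℝ)| ≤ K * r ^ n) →
      ∀ n : ℕ, |(chooseSum c).eval (n : ℝ)| ≤ K * r ^ n := by
  have hfin := finite_forall_abs_chooseSum_le D fun n => K * r ^ n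
  obtain ⟨N, hN⟩ := Filter.eventually_atTop.1 <|
    (Filter.eventually_all_finite hfin).2 fun c _ => eventually_abs_eval_le (chooseSum c) hK hr
  refine ⟨max N D, fun c hc n => ?_⟩
  rcases lt_or_ge n (max N D) with h | h
  · exact hc n h
  · exact hN n (le_of_max_le_left h) c fun k hk => hc k (hk.trans_le (le_max_right _ _))

/-- The change of basis from scaled Meixner functions to binomial coefficients. -/
noncomputable def meixnerMatrix (D : ℕ) : Matrix (Fin D) (Fin D) ℝ :=
  (Real.sqrt 8)⁻¹ • Matrix.of fun j k : Fin D =>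
    ((Polynomial.C phi⁻¹ - Polynomial.X) ^ (k : ℕ) : Polynomial ℝ).coeff j

theorem abs_det_meixnerMatrix (D : ℕ) : |(meixnerMatrix D).det| = (Real.sqrt 8)⁻¹ ^ D := by
  rw [meixnerMatrix, Matrix.det_smul, Matrix.det_of_isUpperTriangular fun k j hkj => ?_]
  · simp [coeff_C_sub_X_pow_self, abs_mul, Finset.abs_prod, abs_of_nonneg]
  · exact coeff_C_sub_X_pow_of_lt _ hkj

theorem sum_meixnerMatrix_mulVec_mul_choose (D : ℕ) (g : Fin D → ℝ) (n : ℕ) :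
    ∑ j, (meixnerMatrix D).mulVec g j * (n.choose j : ℝ) =
      (Real.sqrt 8)⁻¹ * phi ^ n * ∑ k : Fin D, meixner k n * g k := by
  have h : ∀ k : Fin D, ∑ j : Fin D, ((Polynomial.C phi⁻¹ - Polynomial.X) ^ (k : ℕ) :
      Polynomial ℝ).coeff j * (n.choose j : ℝ) = phi ^ n * meixner k n := by
    intro k
    rw [phi_pow_mul_meixner, Fin.sum_univ_eq_sum_range (fun j => ((Polynomial.C phi⁻¹ -
      Polynomial.X) ^ (k : ℕ) : Polynomial ℝ).coeff j * (n.choose j : ℝ)) D]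
    refine (Finset.sum_subset (Finset.range_mono k.2) fun j _ hj => ?_).symm
    rw [coeff_C_sub_X_pow_of_lt _ (by simpa using hj), zero_mul]
  simp only [meixnerMatrix, Matrix.mulVec, dotProduct, Matrix.smul_apply, Matrix.of_apply,
    smul_eq_mul, Finset.sum_mul, Finset.mul_sum]
  rw [Finset.sum_comm]
  refine Finset.sum_congr rfl fun k _ => ?_
  rw [mul_assoc, ← mul_assoc _ (meixner _ _), ← h k, Finset.sum_mul, Finset.mul_sum]
  exact Finset.sum_congr rfl fun j _ => by ring

theorem exp_le_mul_of_encard_chooseSum_le {D : ℕ} (hD : 0 < D) {m : ℕ}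
    (hm : {c : Fin D → ℤ | ∀ n : ℕ, |(chooseSum c).eval (n : ℝ)| ≤
      Real.sqrt (2 * phi) * phi ^ n}.encard ≤ m) :
    Real.exp (D * ((1 + Real.log (2 * Real.pi)) / 2 - 2 * Real.exp (-2))) ≤
      Real.sqrt 8 ^ D * m := by
  have hφ := phi_pos
  obtain ⟨N, hN⟩ := exists_forall_lt_imp_forall D
    (Real.sqrt_pos.2 (mul_pos two_pos hφ)) one_lt_phi
  let v : Fin N → Fin D → ℝ := fun n k => meixner k n / Real.sqrt phi
  let A : (Fin N → ℤ) → Set (Fin D → ℝ) := fun z => {x | ∀ n : Fin N,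
    round ((∑ j, x j * ((n : ℕ).choose j : ℝ)) / (Real.sqrt (2 * phi) * phi ^ (n : ℕ))) = z n}
  have hA : ∀ z, volume (A z) ≤ m := by
    intro z
    refine volume_le_of_encard_lattice_le ?_ fun x => ?_
    · simp only [A, Set.ofPred_forall]
      refine MeasurableSet.iInter fun n => ?_
      exact (measurable_round_real.comp (by fun_prop)) (measurableSet_singleton (z n))
    · rcases Set.eq_empty_or_nonempty {c : Fin D → ℤ | (fun i => (c i : ℝ) + x i) ∈ A z}
        with h | ⟨c₀, hc₀⟩
      · simp [h]
      · rw [← (sub_left_injective (b := c₀)).encard_image]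
        refine (Set.encard_le_encard ?_).trans hm
        rintro _ ⟨c, hc, rfl⟩
        refine hN _ fun n hn => ?_
        have hpos : 0 < Real.sqrt (2 * phi) * phi ^ n := by positivity
        have h := abs_sub_le_one_of_round_eq ((hc ⟨n, hn⟩).trans (hc₀ ⟨n, hn⟩).symm)
        rw [← sub_div, abs_div, abs_of_pos hpos, div_le_one hpos, ← Finset.sum_sub_distrib] at h
        rw [eval_chooseSum]
        refine (congrArg abs (Finset.sum_congr rfl fun j _ => ?_)).trans_le h
        simp only [Pi.sub_apply, Int.cast_sub]
        ring
  have hdet : LinearMap.det (Matrix.toLin' (meixnerMatrix D)) ≠ 0 := by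
    rw [LinearMap.det_toLin', ← abs_pos, abs_det_meixnerMatrix]
    positivity
  have hcell : ∀ z : Fin N → ℤ,
      volume {g : Fin D → ℝ | ∀ n, round ((∑ k, v n k * g k) / 4) = z n} ≤
        ENNReal.ofReal (Real.sqrt 8 ^ D) * m := by
    intro z
    have hpre : {g : Fin D → ℝ | ∀ n, round ((∑ k, v n k * g k) / 4) = z n} =
        Matrix.toLin' (meixnerMatrix D) ⁻¹' A z := by
      ext g
      refine forall_congr' fun n => ?_
      rw [Matrix.toLin'_apply, sum_meixnerMatrix_mulVec_mul_choose]
      have h8 : Real.sqrt 8 * Real.sqrt (2 * phi) = 4 * Real.sqrt phi := by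
        rw [← Real.sqrt_mul (by norm_num), ← mul_assoc, Real.sqrt_mul (by norm_num),
          show (8 * 2 : ℝ) = 4 ^ 2 by norm_num, Real.sqrt_sq (by norm_num)]
      have hv : ∑ k, v n k * g k = (∑ k : Fin D, meixner k n * g k) / Real.sqrt phi := by
        rw [Finset.sum_div]
        exact Finset.sum_congr rfl fun k _ => by simp only [v]; ring
      have : (∑ k, v n k * g k) / 4 = (Real.sqrt 8)⁻¹ * phi ^ (n : ℕ) *
          (∑ k : Fin D, meixner k n * g k) / (Real.sqrt (2 * phi) * phi ^ (n : ℕ)) := by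
        rw [hv, div_div, mul_comm _ (4 : ℝ), ← h8]
        field_simp
      rw [this]
    rw [hpre, Measure.addHaar_preimage_linearMap _ hdet, LinearMap.det_toLin', abs_inv,
      abs_det_meixnerMatrix, inv_pow, inv_inv]
    gcongr
    exact hA z
  have hsq : Real.sqrt phi ^ 2 = phi := Real.sq_sqrt hφ.le
  have hcost := ofReal_exp_le_of_volume_cell_le v (fun n => ?_) (fun n => ?_) ?_ hcell
  · rw [Fintype.card_fin, ← ENNReal.ofReal_natCast, ← ENNReal.ofReal_mul (by positivity)] at hcost
    exact (ENNReal.ofReal_le_ofReal_iff (by positivity)).1 hcost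
  · refine Finset.sum_pos' (fun k _ => sq_nonneg _) ⟨⟨0, hD⟩, Finset.mem_univ _, ?_⟩
    simp only [v, meixner]
    positivity
  · simp only [v, div_pow, hsq, ← Finset.sum_div]
    rw [div_le_one hφ, Fin.sum_univ_eq_sum_range (fun k => meixner k n ^ 2) D]
    simpa only [meixner_comm _ (n : ℕ)] using sum_meixner_sq_le n D
  · rw [Finset.sum_comm, Fintype.card_fin]
    calc ∑ k : Fin D, ∑ n, v n k ^ 2 ≤ ∑ k : Fin D, (1 : ℝ) := by
          refine Finset.sum_le_sum fun k _ => ?_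
          simp only [v, div_pow, hsq, ← Finset.sum_div]
          rw [div_le_one hφ, Fin.sum_univ_eq_sum_range (fun n => meixner k n ^ 2) N]
          exact sum_meixner_sq_le k N
      _ = D := by simp

theorem sqrt_eight_lt_exp :
    Real.sqrt 8 < Real.exp ((1 + Real.log (2 * Real.pi)) / 2 - 2 * Real.exp (-2)) := by
  have hπ := Real.pi_gt_d2
  rw [← Real.log_lt_iff_lt_exp (by positivity), Real.log_sqrt (by norm_num)]
  have h8 : Real.log 8 = Real.log (2 * Real.pi) - Real.log (Real.pi / 4) := by
    rw [← Real.log_div (by positivity) (by positivity)]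
    congr 1
    field_simp
    norm_num
  have hlog : 1 - (Real.pi / 4)⁻¹ ≤ Real.log (Real.pi / 4) :=
    Real.one_sub_inv_le_log_of_pos (by positivity)
  have hinv : (Real.pi / 4)⁻¹ < 1.28 := by
    rw [inv_lt_comm₀ (by positivity) (by norm_num)]
    norm_num
    linarith
  have hexp : Real.exp (-2) < 1 / 7 := by
    rw [Real.exp_neg, inv_lt_comm₀ (Real.exp_pos _) (by norm_num),
      show (2 : ℝ) = 1 + 1 by norm_num, Real.exp_add]
    nlinarith [Real.exp_one_gt_d9]
  rw [h8]
  linarith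

/-- For every `ε > 0`, there are infinitely many integer-valued polynomials `P`
with `|P(n)| ≤ (√(2φ) + ε)·φ^n` for all natural numbers `n`. -/
theorem stmt_0 (ε : ℝ) (hε : 0 < ε) :
    {P : Polynomial ℝ | IsIVP P ∧
      ∀ n : ℕ, |P.eval (n : ℝ)| ≤ (Real.sqrt (2 * phi) + ε) * phi ^ n}.Infinite := by
  have hφ := phi_pos
  intro hfin
  obtain ⟨m, hm⟩ := ENat.ne_top_iff_exists.1 (Set.encard_ne_top_iff.2 hfin)
  have hcard : ∀ D : ℕ, {c : Fin D → ℤ | ∀ n : ℕ, |(chooseSum c).eval (n : ℝ)| ≤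
      Real.sqrt (2 * phi) * phi ^ n}.encard ≤ m := by
    intro D
    rw [hm, ← (chooseSum_injective D).encard_image]
    refine Set.encard_le_encard ?_
    rintro _ ⟨c, hc, rfl⟩
    exact ⟨isIVP_chooseSum c, fun n => (hc n).trans (by gcongr; linarith)⟩
  have h8 : 0 < Real.sqrt 8 := by positivity
  obtain ⟨D, hD⟩ := pow_unbounded_of_one_lt (m : ℝ) ((one_lt_div h8).2 sqrt_eight_lt_exp)
  have hD' := hD.trans (pow_lt_pow_right₀ ((one_lt_div h8).2 sqrt_eight_lt_exp) D.lt_succ_self)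
  rw [div_pow, lt_div_iff₀ (by positivity), ← Real.exp_nat_mul, mul_comm] at hD'
  exact hD'.not_ge (exp_le_mul_of_encard_chooseSum_le D.succ_pos (hcard (D + 1)))
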